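/- The distance from the 6-variable Boolean function f₄ = X₁X₂X₃ + X₄X₅X₆ to RM(2,6) equals 14; that is, the minimum over Boolean functions p of degree at most 2 of the weight of f₄ + p is 14. -/

import Mathlib

open MvPolynomial

/-- A Boolean function on `m` variables over 𝔽₂. -/
abbrev BF (m : ℕ) := (Fin m → ZMod 2) → ZMod 2

/-- The unique multilinear polynomial over 𝔽₂ representing the Boolean function `f`
(obtained by interpolation: `∏ i (Xᵢ + vᵢ + 1)` is the indicator of the input `v`). -/
noncomputable def repPoly {m : ℕ} (f : BF m) : MvPolynomial (Fin m) (ZMod 2) :=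
  ∑ v : Fin m → ZMod 2, f v • ∏ i : Fin m, (X i + C (v i + 1))

/-- The degree of a Boolean function: the total degree of its multilinear representative. -/
noncomputable def deg {m : ℕ} (f : BF m) : ℕ := (repPoly f).totalDegree

/-- The weight of a Boolean function: the number of inputs on which it takes the value 1. -/
noncomputable def wt {m : ℕ} (f : BF m) : ℕ :=
  (Finset.univ.filter fun v => f v = 1).card

/-- The distance from `f` to the Reed–Muller code `RM(r,m)`: the minimum weight of
`f + p` over Boolean functions `p` of degree at most `r`. -/
noncomputable def distRM (m r : ℕ) (f : BF m) : ℕ :=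
  sInf {w | ∃ p : BF m, deg p ≤ r ∧ wt (f + p) = w}

theorem eval_repPoly {m : ℕ} (f : BF m) (v : Fin m → ZMod 2) :
    eval v (repPoly f) = f v := by
  have h01 : ∀ a b : ZMod 2, a ≠ b → b + (a + 1) = 0 := by decide
  have h1 : ∀ a : ZMod 2, a + (a + 1) = 1 := by decide
  simp only [repPoly, map_sum, smul_eval, map_prod, map_add, eval_X, eval_C]
  rw [Finset.sum_eq_single v]
  · simp [h1]
  · intro w _ hw
    obtain ⟨i, hi⟩ := Function.ne_iff.mp hw
    rw [Finset.prod_eq_zero (Finset.mem_univ i) (h01 _ _ hi), mul_zero]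
  · simp

theorem exists_quadratic_of_deg_le_two {m : ℕ} (p : BF m) (hp : deg p ≤ 2) :
    ∃ (c : ZMod 2) (B : Fin m → Fin m → ZMod 2), ∀ v,
      p v = c + ∑ i, ∑ j, B i j * (v i * v j) := by
  have hsq : ∀ a : ZMod 2, a * a = a := by decide
  suffices H : ∀ q : MvPolynomial (Fin m) (ZMod 2), q.totalDegree ≤ 2 →
      ∃ (c : ZMod 2) (B : Fin m → Fin m → ZMod 2), ∀ v,
        eval v q = c + ∑ i, ∑ j, B i j * (v i * v j) by
    obtain ⟨c, B, h⟩ := H (repPoly p) hp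
    exact ⟨c, B, fun v => by rw [← eval_repPoly p v, h]⟩
  have monomial_case : ∀ d : Fin m →₀ ℕ, d.degree ≤ 2 →
      ∃ (c : ZMod 2) (B : Fin m → Fin m → ZMod 2), ∀ v : Fin m → ZMod 2,
        (d.prod fun i k => v i ^ k) = c + ∑ i, ∑ j, B i j * (v i * v j) := by
    intro d hd
    have hprod : ∀ v : Fin m → ZMod 2,
        (d.prod fun i k => v i ^ k) = (d.toMultiset.map v).prod := by
      intro v
      rw [Finsupp.toMultiset_map, Finsupp.prod_toMultiset, Finsupp.prod_mapDomain_index] <;>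
        simp [pow_add]
    have hcard : d.toMultiset.card ≤ 2 := by
      rw [Finsupp.card_toMultiset]; exact hd
    have single : ∀ a b : Fin m, ∀ v : Fin m → ZMod 2,
        v a * v b = 0 + ∑ i, ∑ j, (if i = a ∧ j = b then 1 else 0) * (v i * v j) := by
      intro a b v
      simp [ite_and]
    simp only [hprod]
    generalize d.toMultiset = s at hcard
    interval_cases h : s.card
    · rw [Multiset.card_eq_zero] at h
      exact ⟨1, 0, fun v => by simp [h]⟩
    · obtain ⟨a, rfl⟩ := Multiset.card_eq_one.mp h
      exact ⟨0, _, fun v => by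
        rw [Multiset.map_singleton, Multiset.prod_singleton, ← hsq (v a)]; exact single a a v⟩
    · obtain ⟨a, b, rfl⟩ := Multiset.card_eq_two.mp h
      exact ⟨0, _, fun v => by
        rw [Multiset.insert_eq_cons, Multiset.map_cons, Multiset.prod_cons,
          Multiset.map_singleton, Multiset.prod_singleton]
        exact single a b v⟩
  intro q hq
  have hd : ∀ d ∈ q.support, d.degree ≤ 2 := fun d h => (le_totalDegree h).trans hq
  choose! c B h using monomial_case
  refine ⟨∑ d ∈ q.support, coeff d q * c d, fun i j => ∑ d ∈ q.support, coeff d q * B d i j,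
    fun v => ?_⟩
  have key : eval v q = ∑ d ∈ q.support, coeff d q * (d.prod fun i k => v i ^ k) := by
    rw [eval_eq]
    refine Finset.sum_congr rfl fun d _ => ?_
    rw [Finsupp.prod]
  rw [key, Finset.sum_congr rfl fun d hd' => by rw [h d (hd d hd') v]]
  simp only [mul_add, Finset.sum_add_distrib, Finset.mul_sum, Finset.sum_mul]
  congr 1
  rw [Finset.sum_comm]
  refine Finset.sum_congr rfl fun i _ => ?_
  rw [Finset.sum_comm]
  simp only [mul_assoc]

/-- Third-order differences of a function of degree at most two vanish. -/
theorem third_difference_eq_zero {m : ℕ} (p : BF m) (hp : deg p ≤ 2)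
    (u a b c : Fin m → ZMod 2) :
    p u + p (u + a) + p (u + b) + p (u + c) + p (u + a + b) + p (u + a + c) + p (u + b + c) +
      p (u + a + b + c) = 0 := by
  obtain ⟨k, B, h⟩ := exists_quadratic_of_deg_le_two p hp
  have h8 : k + k + k + k + k + k + k + k = 0 := by clear h; revert k; decide
  have hsum : ∑ i, ∑ j, B i j * (u i * u j) + ∑ i, ∑ j, B i j * ((u + a) i * (u + a) j) +
      ∑ i, ∑ j, B i j * ((u + b) i * (u + b) j) + ∑ i, ∑ j, B i j * ((u + c) i * (u + c) j) +
      ∑ i, ∑ j, B i j * ((u + a + b) i * (u + a + b) j) +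
      ∑ i, ∑ j, B i j * ((u + a + c) i * (u + a + c) j) +
      ∑ i, ∑ j, B i j * ((u + b + c) i * (u + b + c) j) +
      ∑ i, ∑ j, B i j * ((u + a + b + c) i * (u + a + b + c) j) = 0 := by
    simp only [← Finset.sum_add_distrib, Pi.add_apply]
    refine Finset.sum_eq_zero fun i _ => Finset.sum_eq_zero fun j _ => ?_
    have h2 : (2 : ZMod 2) = 0 := rfl
    linear_combination (B i j * (4 * u i * u j + 2 * u i * (a j + b j + c j) +
      2 * (a i + b i + c i) * u j + 2 * a i * a j + 2 * b i * b j + 2 * c i * c j + a i * b j +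
      b i * a j + a i * c j + c i * a j + b i * c j + c i * b j)) * h2
  simp only [h]
  linear_combination h8 + hsum

/-- A `0`-`1` matrix of order eight whose row and column sums are all odd, and whose rows of
weight one all coincide, has at least fourteen ones. -/
theorem fourteen_le_sum_of_odd {A : Type*} [Fintype A] [DecidableEq A]
    (hA : Fintype.card A = 8) (R : A → A → Prop) [∀ x y, Decidable (R x y)]
    (hrow : ∀ x, Odd (Finset.univ.filter fun y => R x y).card)
    (hcol : ∀ y, Odd (Finset.univ.filter fun x => R x y).card)
    (huniq : ∀ x x' p p', (∀ y, R x y ↔ y = p) → (∀ y, R x' y ↔ y = p') → p = p') :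
    14 ≤ ∑ x, (Finset.univ.filter fun y => R x y).card := by
  set S := Finset.univ.filter fun x => (Finset.univ.filter fun y => R x y).card = 1 with hS
  have hcompl : S.card + (Finset.univ.filter fun x =>
      ¬ (Finset.univ.filter fun y => R x y).card = 1).card = 8 := by
    rw [hS, Finset.card_filter_add_card_filter_not, Finset.card_univ, hA]
  rcases le_or_gt S.card 5 with hle | hgt
  · have hbound : ∑ x : A, (1 + if (Finset.univ.filter fun y => R x y).card = 1 then 0 else 2) ≤
        ∑ x, (Finset.univ.filter fun y => R x y).card := by
      refine Finset.sum_le_sum fun x _ => ?_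
      obtain ⟨k, hk⟩ := hrow x
      split_ifs <;> omega
    refine le_trans ?_ hbound
    rw [Finset.sum_add_distrib, Finset.sum_ite]
    simp only [Finset.sum_const, Finset.card_univ, hA, smul_eq_mul]
    omega
  · have point : ∀ x ∈ S, ∃ p, ∀ y, R x y ↔ y = p := by
      intro x hx
      obtain ⟨p, hp⟩ := Finset.card_eq_one.mp (Finset.mem_filter.mp hx).2
      exact ⟨p, fun y => by simpa using Finset.ext_iff.mp hp y⟩
    obtain ⟨x₀, hx₀⟩ := Finset.card_pos.mp (by omega : 0 < S.card)
    obtain ⟨p, hp⟩ := point x₀ hx₀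
    have hsub : S ⊆ Finset.univ.filter fun x => R x p := by
      intro x hx
      obtain ⟨p', hp'⟩ := point x hx
      simpa using (hp' p).mpr (huniq _ _ _ _ hp hp')
    have hcolp := Finset.card_le_card hsub
    have hswap : ∑ x, (Finset.univ.filter fun y => R x y).card =
        ∑ y, (Finset.univ.filter fun x => R x y).card := by
      simp only [Finset.card_filter]
      exact Finset.sum_comm
    have hbound : ∑ y : A, (1 + if y = p then 6 else 0) ≤
        ∑ y, (Finset.univ.filter fun x => R x y).card := by
      refine Finset.sum_le_sum fun y _ => ?_
      obtain ⟨k, hk⟩ := hcol y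
      split_ifs with hy
      · subst hy; omega
      · omega
    rw [hswap]
    refine le_trans ?_ hbound
    simp [Finset.sum_add_distrib, hA]

/-- The point of `𝔽₂⁶` with the given halves. -/
def joinHalves (x y : ZMod 2 × ZMod 2 × ZMod 2) : Fin 6 → ZMod 2 :=
  ![x.1, x.2.1, x.2.2, y.1, y.2.1, y.2.2]

theorem joinHalves_add (x x' y y' : ZMod 2 × ZMod 2 × ZMod 2) :
    joinHalves (x + x') (y + y') = joinHalves x y + joinHalves x' y' := by
  ext i
  fin_cases i <;> rfl

theorem joinHalves_injective :
    Function.Injective fun z : (ZMod 2 × ZMod 2 × ZMod 2) × (ZMod 2 × ZMod 2 × ZMod 2) =>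
      joinHalves z.1 z.2 := by
  rintro ⟨⟨a, b, c⟩, ⟨d, e, f⟩⟩ ⟨⟨a', b', c'⟩, ⟨d', e', f'⟩⟩ h
  simpa [joinHalves, and_assoc] using h

theorem odd_card_filter_of_sum_eq_one {A : Type*} [Fintype A] (g : A → ZMod 2)
    (h : ∑ x, g x = 1) : Odd (Finset.univ.filter fun x => g x = 1).card := by
  have h01 : ∀ a : ZMod 2, (if a = 1 then (1 : ZMod 2) else 0) = a := by decide
  rw [← ZMod.natCast_eq_one_iff_odd, Finset.natCast_card_filter]
  exact (Finset.sum_congr rfl fun x _ => h01 (g x)).trans h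

theorem sum_triples (g : ZMod 2 × ZMod 2 × ZMod 2 → ZMod 2) :
    ∑ x, g x = g (0, 0, 0) + g (1, 0, 0) + g (0, 1, 0) + g (0, 0, 1) + g (1, 1, 0) +
      g (1, 0, 1) + g (0, 1, 1) + g (1, 1, 1) := by
  have h2 : ∀ k : ZMod 2 → ZMod 2, ∑ a, k a = k 0 + k 1 := fun k => Fin.sum_univ_two k
  simp only [Fintype.sum_prod_type, h2]
  ring

/-- The eight points of the flat spanned by three directions, in split coordinates. -/
theorem third_difference_joinHalves (p : BF 6) (hp : deg p ≤ 2)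
    (x y a a' b b' c c' : ZMod 2 × ZMod 2 × ZMod 2) :
    p (joinHalves x y) + p (joinHalves (x + a) (y + a')) + p (joinHalves (x + b) (y + b')) +
      p (joinHalves (x + c) (y + c')) + p (joinHalves (x + a + b) (y + a' + b')) +
      p (joinHalves (x + a + c) (y + a' + c')) + p (joinHalves (x + b + c) (y + b' + c')) +
      p (joinHalves (x + a + b + c) (y + a' + b' + c')) = 0 := by
  simpa only [joinHalves_add] using third_difference_eq_zero p hp (joinHalves x y)
    (joinHalves a a') (joinHalves b b') (joinHalves c c')

theorem sum_right_eq_zero (p : BF 6) (hp : deg p ≤ 2) (x : ZMod 2 × ZMod 2 × ZMod 2) :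
    ∑ y, p (joinHalves x y) = 0 := by
  rw [sum_triples]
  simpa [← Prod.zero_eq_mk] using third_difference_joinHalves p hp x 0 0 (1, 0, 0) 0 (0, 1, 0) 0 (0, 0, 1)

theorem sum_left_eq_zero (p : BF 6) (hp : deg p ≤ 2) (y : ZMod 2 × ZMod 2 × ZMod 2) :
    ∑ x, p (joinHalves x y) = 0 := by
  rw [sum_triples]
  simpa [← Prod.zero_eq_mk] using third_difference_joinHalves p hp 0 y (1, 0, 0) 0 (0, 1, 0) 0 (0, 0, 1) 0

/-- Sums over a translated plane in the right half do not depend on the left half. -/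
theorem sum_plane_eq (p : BF 6) (hp : deg p ≤ 2) (x x' y b c : ZMod 2 × ZMod 2 × ZMod 2) :
    p (joinHalves x y) + p (joinHalves x (y + b)) + p (joinHalves x (y + c)) +
      p (joinHalves x (y + b + c)) =
    p (joinHalves x' y) + p (joinHalves x' (y + b)) + p (joinHalves x' (y + c)) +
      p (joinHalves x' (y + b + c)) := by
  have hxx : x + (x + x') = x' := by revert x x'; decide
  have h := third_difference_joinHalves p hp x y (x + x') 0 0 b 0 c
  simp only [hxx, add_zero] at h
  rw [← sub_eq_zero, CharTwo.sub_eq_add]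
  linear_combination h

theorem fourteen_le_wt_add (p : BF 6) (hp : deg p ≤ 2) :
    14 ≤ wt ((fun v : Fin 6 → ZMod 2 => v 0 * v 1 * v 2 + v 3 * v 4 * v 5) + p) := by
  set f : BF 6 := fun v => v 0 * v 1 * v 2 + v 3 * v 4 * v 5
  have hfj : ∀ x y, f (joinHalves x y) = x.1 * x.2.1 * x.2.2 + y.1 * y.2.1 * y.2.2 :=
    fun _ _ => rfl
  have hcount : ∑ x, (Finset.univ.filter fun y => (f + p) (joinHalves x y) = 1).card ≤
      wt (f + p) := by
    simp only [Finset.card_filter, wt]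
    rw [← Fintype.sum_prod_type'
      (f := fun x y => if (f + p) (joinHalves x y) = 1 then 1 else 0),
      ← Finset.card_filter, ← Finset.card_filter]
    exact Finset.card_le_card_of_injOn _ (fun z hz => by simpa using hz)
      joinHalves_injective.injOn
  refine le_trans (fourteen_le_sum_of_odd (by simp [ZMod.card]) _ ?_ ?_ ?_) hcount
  · intro x
    apply odd_card_filter_of_sum_eq_one
    simp only [Pi.add_apply, Finset.sum_add_distrib, sum_right_eq_zero p hp, hfj]
    revert x; decide
  · intro y
    apply odd_card_filter_of_sum_eq_one
    simp only [Pi.add_apply, Finset.sum_add_distrib, sum_left_eq_zero p hp, hfj]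
    revert y; decide
  · intro x x' q q' hq hq'
    have point : ∀ x q, (∀ y, (f + p) (joinHalves x y) = 1 ↔ y = q) →
        ∀ y, (f + p) (joinHalves x y) = if y = q then 1 else 0 := by
      intro x q h y
      have h01 : ∀ a : ZMod 2, a ≠ 1 → a = 0 := by decide
      split_ifs with hy
      · exact (h y).mpr hy
      · exact h01 _ (mt (h y).mp hy)
    have plane : ∀ b c, ((if q = q then 1 else 0) + (if q + b = q then 1 else 0) +
        (if q + c = q then 1 else 0) + (if q + b + c = q then 1 else 0) : ZMod 2) =
        (if q = q' then 1 else 0) + (if q + b = q' then 1 else 0) +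
        (if q + c = q' then 1 else 0) + (if q + b + c = q' then 1 else 0) := by
      intro b c
      rw [← point x q hq q, ← point x q hq (q + b), ← point x q hq (q + c),
        ← point x q hq (q + b + c), ← point x' q' hq' q, ← point x' q' hq' (q + b),
        ← point x' q' hq' (q + c), ← point x' q' hq' (q + b + c)]
      simp only [Pi.add_apply, hfj]
      have h2 : (2 : ZMod 2) = 0 := rfl
      linear_combination sum_plane_eq p hp x x' q b c +
        2 * (x.1 * x.2.1 * x.2.2 - x'.1 * x'.2.1 * x'.2.2) * h2
    have h1 := plane (1, 0, 0) (0, 1, 0)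
    have h2 := plane (1, 0, 0) (0, 0, 1)
    have h3 := plane (0, 1, 0) (0, 0, 1)
    clear plane point hq hq'
    revert q q'
    decide

/-- The distance from `f₄ = X₁X₂X₃ + X₄X₅X₆` to `RM(2,6)` equals 14. -/
theorem stmt12 :
    distRM 6 2 (fun v : Fin 6 → ZMod 2 => v 0 * v 1 * v 2 + v 3 * v 4 * v 5) = 14 := by
  have hmem : 14 ∈ {w | ∃ p : BF 6, deg p ≤ 2 ∧
      wt ((fun v : Fin 6 → ZMod 2 => v 0 * v 1 * v 2 + v 3 * v 4 * v 5) + p) = w} := by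
    refine ⟨0, by simp [deg, repPoly], ?_⟩
    rw [add_zero, wt]
    decide +kernel
  refine le_antisymm (Nat.sInf_le hmem) (le_csInf ⟨14, hmem⟩ ?_)
  rintro w ⟨p, hp, rfl⟩
  exact fourteen_le_wt_add p hp
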